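/- Let p and q be distinct primes and let D be a group that is an internal semidirect product D = A ⋊ B of a cyclic p-group A (normal in D) and a subgroup B of order q, with [A, B] ≠ 1. If N is a normal subgroup of D whose order is divisible by q, then N = D. -/

import Mathlib

/-- A subgroup containing a subgroup of prime index and an element outside it is everything. -/
theorem Subgroup.eq_top_of_prime_index_le {G : Type*} [Group G] {A H : Subgroup G}
    (hA : A.index.Prime) (hle : A ≤ H) {x : G} (hxH : x ∈ H) (hxA : x ∉ A) : H = ⊤ := by
  have h := Subgroup.relIndex_mul_index hle
  rcases (Nat.dvd_prime hA).1 (Dvd.intro_left _ h) with h1 | h1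
  · exact Subgroup.index_eq_one.1 h1
  · rw [h1] at h
    have h2 : A.relIndex H = 1 := by
      simpa using Nat.eq_of_mul_eq_mul_right hA.pos (h.trans (one_mul _).symm)
    exact absurd (Subgroup.relIndex_eq_one.1 h2 hxH) hxA

/-- The kernel of reduction modulo `p` on units modulo `p ^ n` has no elements of order `q ≠ p`. -/
theorem Int.prime_pow_dvd_sub_one_of_dvd_pow_sub_one {p q n : ℕ} (hp : p.Prime) (hq : q.Prime)
    (hpq : p ≠ q) {k : ℤ} (hk : (p : ℤ) ∣ k - 1) (h : (p : ℤ) ^ n ∣ k ^ q - 1) :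
    (p : ℤ) ^ n ∣ k - 1 := by
  have hsum : (∑ i ∈ Finset.range q, k ^ i) ≡ q [ZMOD p] := by
    have hk1 : k ≡ 1 [ZMOD p] := (Int.modEq_iff_dvd.2 hk).symm
    rw [← ZMod.intCast_eq_intCast_iff] at hk1 ⊢
    push_cast at hk1 ⊢
    simp [hk1]
  have hcop : IsCoprime (p : ℤ) (∑ i ∈ Finset.range q, k ^ i) := by
    rw [Prime.coprime_iff_not_dvd (Nat.prime_iff_prime_int.1 hp)]
    intro hd
    have hpq' : (p : ℤ) ∣ q := hsum.dvd_iff.1 hd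
    exact hpq ((Nat.prime_dvd_prime_iff_eq hp hq).1 (Int.natCast_dvd_natCast.1 hpq'))
  rw [← geom_sum_mul] at h
  exact hcop.pow_left.dvd_of_dvd_mul_left h

/-- If `x` conjugates `a` to `a ^ k`, then `x ^ i` conjugates `a` to `a ^ (k ^ i)`. -/
theorem conj_pow_eq_zpow_pow {G : Type*} [Group G] {x a : G} {k : ℤ}
    (h : x * a * x⁻¹ = a ^ k) (i : ℕ) : x ^ i * a * (x ^ i)⁻¹ = a ^ (k ^ i) := by
  induction i with
  | zero => simp
  | succ i ih =>
    calc x ^ (i + 1) * a * (x ^ (i + 1))⁻¹ = x * (x ^ i * a * (x ^ i)⁻¹) * x⁻¹ := by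
          rw [pow_succ']; group
      _ = a ^ (k ^ (i + 1)) := by rw [ih, ← conj_zpow, h, ← zpow_mul, pow_succ']

theorem normal_subgroup_of_order_div_q_eq_top {p q : ℕ} (hp : p.Prime) (hq : q.Prime)
    (hpq : p ≠ q)
    {D : Type*} [Group D] (A B : Subgroup D) (hAnorm : A.Normal)
    (hAcyc : IsCyclic A) (hAp : IsPGroup p A) (hBq : Nat.card B = q)
    (hint : A ⊓ B = ⊥) (hjoin : A ⊔ B = ⊤) (hcomm : ⁅A, B⁆ ≠ ⊥)
    (N : Subgroup D) (hN : N.Normal) (hdvd : q ∣ Nat.card N) :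
    N = ⊤ := by
  have hcompl : Subgroup.IsComplement' B A := by
    refine (Subgroup.isComplement'_of_disjoint_and_mul_eq_univ (disjoint_iff.2 hint) ?_).symm
    rw [← Subgroup.normal_mul, hjoin, Subgroup.coe_top]
  have hindex : A.index = q := hcompl.index_eq_card.trans hBq
  obtain ⟨a, ha⟩ := A.isCyclic_iff_exists_zpowers_eq_top.1 hAcyc
  have haA : a ∈ A := ha ▸ Subgroup.mem_zpowers a
  obtain ⟨n, hn⟩ : ∃ n, orderOf a = p ^ n := by
    have := Fact.mk hp
    obtain ⟨n, hn⟩ := IsPGroup.iff_orderOf.1 hAp ⟨a, haA⟩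
    exact ⟨n, by rwa [Subgroup.orderOf_mk] at hn⟩
  have hcardA : Nat.card A = p ^ n := by rw [← ha, Nat.card_zpowers, hn]
  have : Finite D := by
    apply Nat.finite_of_card_ne_zero
    rw [← A.card_mul_index, hcardA, hindex]
    exact mul_ne_zero (pow_ne_zero _ hp.ne_zero) hq.ne_zero
  obtain ⟨x, hxN, hxq⟩ : ∃ x ∈ N, orderOf x = q := by
    have := Fact.mk hq
    obtain ⟨x, hx⟩ := exists_prime_orderOf_dvd_card' q hdvd
    exact ⟨x, x.2, by rwa [Subgroup.orderOf_coe]⟩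
  have hxA : x ∉ A := by
    intro hx
    have h := A.orderOf_dvd_natCard hx
    rw [hxq, hcardA] at h
    exact hpq ((Nat.prime_dvd_prime_iff_eq hq hp).1 (hq.dvd_of_dvd_pow h)).symm
  have hprime : A.index.Prime := hindex ▸ hq
  obtain ⟨k, hk⟩ := Subgroup.mem_zpowers_iff.1 (ha.symm ▸ hAnorm.conj_mem a haA x)
  have hkq : (p : ℤ) ^ n ∣ k ^ q - 1 := by
    have h := conj_pow_eq_zpow_pow hk.symm q
    rw [← hxq, pow_orderOf_eq_one, hxq] at h
    have h1 : a ^ (k ^ q - 1) = 1 := by rw [zpow_sub_one, ← h]; group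
    simpa [hn] using orderOf_dvd_iff_zpow_eq_one.2 h1
  have haN : a ^ (k - 1) ∈ N := by
    rw [zpow_sub_one, hk, mul_assoc, mul_assoc, ← mul_assoc a]
    exact N.mul_mem hxN (hN.conj_mem _ (N.inv_mem hxN) a)
  by_cases hpk : (p : ℤ) ∣ k - 1
  · exfalso
    have h := Int.prime_pow_dvd_sub_one_of_dvd_pow_sub_one hp hq hpq hpk hkq
    have hak : a ^ (k - 1) = 1 := orderOf_dvd_iff_zpow_eq_one.1 (by simpa [hn] using h)
    have hxa : a * x = x * a := by
      rw [zpow_sub_one, mul_inv_eq_one, hk, mul_inv_eq_iff_eq_mul] at hak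
      exact hak.symm
    have hC : Subgroup.centralizer (A : Set D) = ⊤ := by
      refine Subgroup.eq_top_of_prime_index_le hprime ?_ (x := x) ?_ hxA
      · have := hAcyc.isMulCommutative
        exact Subgroup.le_centralizer A
      · rw [← ha, Subgroup.mem_centralizer_iff]
        rintro _ ⟨m, rfl⟩
        exact (show Commute a x from hxa).zpow_left m
    refine hcomm ?_
    rw [Subgroup.commutator_comm, Subgroup.commutator_eq_bot_iff_le_centralizer, hC]
    exact le_top
  · refine Subgroup.eq_top_of_prime_index_le hprime ?_ hxN hxA
    rw [← ha, Subgroup.zpowers_le]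
    obtain ⟨u, v, huv⟩ : IsCoprime ((p : ℤ) ^ n) (k - 1) :=
      ((Prime.coprime_iff_not_dvd (Nat.prime_iff_prime_int.1 hp)).2 hpk).pow_left
    have hpn : a ^ ((p : ℤ) ^ n) = 1 := by
      rw [← orderOf_dvd_iff_zpow_eq_one, hn]; simp
    have : a = (a ^ (k - 1)) ^ v := by
      conv_lhs => rw [← zpow_one a, ← huv, zpow_add, zpow_mul', zpow_mul', hpn]
      simp
    rw [this]
    exact N.zpow_mem haN v
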